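/- arXiv:1704.05532 — 3 statements merged into one kernel-verified Lean document; each statement's English description precedes it below -/
import Mathlib

section
/- For every integer n ≥ 7, the lattice polytope Q_n(5,2) = {x ∈ ℝ^n : 0 ≤ x_i ≤ 5 for all i, and for every ε ∈ {0,1}^n, Σ_{i=1}^n (ε_i(5 − x_i) + (1 − ε_i)x_i) ≥ 2} has an Ehrhart polynomial with strictly negative linear coefficient: there is a polynomial p ∈ ℚ[t] with p(t) = |tQ_n(5,2) ∩ ℤ^n| for all positive integers t, and the coefficient of t in p equals 5n − 2^{n+1}/n, which is negative for n ≥ 7. -/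
open Pointwise Polynomial

/-- The canonical embedding of integer vectors into real vectors. -/
def intVec {n : ℕ} (z : Fin n → ℤ) : Fin n → ℝ := fun i => (z i : ℝ)

/-- The number of lattice points `|tP ∩ ℤ^n|` in the `t`-th dilate of `P ⊆ ℝ^n`. -/
noncomputable def latticePointCount {n : ℕ} (P : Set (Fin n → ℝ)) (t : ℕ) : ℕ :=
  {z : Fin n → ℤ | intVec z ∈ (t : ℝ) • P}.ncard

/-- The polytope `Q_n(a,b)` obtained from the dilated cube `[0,a]^n` by chiseling off
every vertex at lattice distance `b`. -/
def chiseledCube (n : ℕ) (a b : ℕ) : Set (Fin n → ℝ) :=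
  {x | (∀ i, 0 ≤ x i ∧ x i ≤ (a : ℝ)) ∧
    ∀ ε : Fin n → Bool, (b : ℝ) ≤ ∑ i, if ε i then (a : ℝ) - x i else x i}

/-- The integer points of the cube `[0,A]^n` whose reflection along `ε` has coordinate sum
less than `m`. -/
noncomputable def cornerPoints (n : ℕ) (A m : ℤ) (ε : Fin n → Bool) : Finset (Fin n → ℤ) :=
  {z ∈ Fintype.piFinset fun _ => Finset.Icc 0 A | ∑ i, (if ε i then A - z i else z i) < m}

lemma mem_cornerPoints {n : ℕ} {A m : ℤ} {ε : Fin n → Bool} {z : Fin n → ℤ} :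
    z ∈ cornerPoints n A m ε ↔
      (∀ i, 0 ≤ z i ∧ z i ≤ A) ∧ ∑ i, (if ε i then A - z i else z i) < m := by
  simp [cornerPoints]

lemma card_cornerPoints (n k : ℕ) (A : ℤ) (hA : k ≤ A) (ε : Fin n → Bool) :
    (cornerPoints n A (k + 1) ε).card = (n + k).choose n := by
  have hcard : (Finset.piAntidiag (Finset.univ : Finset (Fin (n + 1))) k).card
      = (n + k).choose n := by
    rw [← Finset.map_sym_eq_piAntidiag, Finset.card_map, Finset.sym_univ, Finset.card_univ,
      Sym.card_sym_eq_choose, Fintype.card_fin]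
    rw [show n + 1 + k - 1 = n + k by omega, ← Nat.choose_symm_add]
  rw [← hcard]
  symm
  refine Finset.card_bij
    (fun f _ i => if ε i then A - (f i.succ : ℤ) else (f i.succ : ℤ)) ?_ ?_ ?_
  · intro f hf
    have hsum : ∑ i, f i = k := by simpa using hf
    rw [Fin.sum_univ_succ] at hsum
    refine mem_cornerPoints.2 ⟨fun i => ?_, ?_⟩
    · have hi : f i.succ ≤ ∑ j : Fin n, f j.succ :=
        Finset.single_le_sum (f := fun j : Fin n => f j.succ) (fun _ _ => Nat.zero_le _)
          (Finset.mem_univ i)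
      split_ifs <;> omega
    · have : ∀ i : Fin n, (if ε i then A - (if ε i then A - (f i.succ : ℤ) else f i.succ)
          else (if ε i then A - (f i.succ : ℤ) else f i.succ)) = (f i.succ : ℤ) := by
        intro i; split_ifs <;> ring
      simp only [this]
      rw [← Nat.cast_sum]
      omega
  · intro f hf g hg hfg
    have hf' : ∑ i, f i = k := by simpa using hf
    have hg' : ∑ i, g i = k := by simpa using hg
    have hsucc : ∀ i : Fin n, f i.succ = g i.succ := by
      intro i
      have := congrFun hfg i
      split_ifs at this <;> omega
    rw [Fin.sum_univ_succ] at hf' hg'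
    simp only [hsucc] at hf'
    funext i
    refine Fin.cases ?_ hsucc i
    omega
  · intro z hz
    obtain ⟨hbox, hlt⟩ := mem_cornerPoints.1 hz
    set w : Fin n → ℤ := fun i => if ε i then A - z i else z i with hw
    have hw0 : ∀ i, ((w i).toNat : ℤ) = w i := by
      intro i
      refine Int.toNat_of_nonneg ?_
      have := hbox i
      simp only [hw]
      split_ifs <;> omega
    have hs : ((∑ i, (w i).toNat : ℕ) : ℤ) < k + 1 := by
      push_cast [hw0]
      exact hlt
    refine ⟨Fin.cons (k - ∑ i, (w i).toNat) fun i => (w i).toNat, ?_, ?_⟩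
    · have : k - ∑ i, (w i).toNat + ∑ i, (w i).toNat = k := by omega
      simpa [Fin.sum_univ_succ] using this
    · funext i
      simp only [Fin.cons_succ, hw0]
      simp only [hw]
      split_ifs <;> ring

lemma pairwiseDisjoint_cornerPoints (n : ℕ) (A m : ℤ) (h : 2 * m ≤ A) (s : Set (Fin n → Bool)) :
    s.PairwiseDisjoint (cornerPoints n A m) := by
  intro ε _ δ _ hne
  refine Finset.disjoint_left.2 fun z hε hδ => ?_
  obtain ⟨hbox, hε⟩ := mem_cornerPoints.1 hε
  obtain ⟨-, hδ⟩ := mem_cornerPoints.1 hδ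
  obtain ⟨j, hj⟩ := Function.ne_iff.1 hne
  have key : A ≤ ∑ i, ((if ε i then A - z i else z i) + (if δ i then A - z i else z i)) := by
    refine le_trans ?_ (Finset.single_le_sum (fun i _ => ?_) (Finset.mem_univ j))
    · rcases hεj : ε j <;> rcases hδj : δ j <;> simp_all
    · have := hbox i
      split_ifs <;> omega
  rw [Finset.sum_add_distrib] at key
  omega

lemma intVec_mem_smul_chiseledCube {n a b t : ℕ} (ht : 0 < t) (z : Fin n → ℤ) :
    intVec z ∈ (t : ℝ) • chiseledCube n a b ↔
      (∀ i, 0 ≤ z i ∧ z i ≤ (a * t : ℤ)) ∧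
        ∀ ε : Fin n → Bool, (b * t : ℤ) ≤ ∑ i, if ε i then (a * t : ℤ) - z i else z i := by
  have ht' : (0 : ℝ) < t := by exact_mod_cast ht
  rw [Set.mem_smul_set_iff_inv_smul_mem₀ ht'.ne']
  simp only [chiseledCube, Set.mem_ofPred_eq, Pi.smul_apply, smul_eq_mul, intVec]
  refine and_congr (forall_congr' fun i => and_congr ?_ ?_) (forall_congr' fun ε => ?_)
  · rw [mul_nonneg_iff_of_pos_left (inv_pos.2 ht')]
    exact_mod_cast Iff.rfl
  · rw [inv_mul_le_iff₀ ht', mul_comm]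
    exact_mod_cast Iff.rfl
  · have : ∀ i, (if ε i then (a : ℝ) - (t : ℝ)⁻¹ * z i else (t : ℝ)⁻¹ * z i)
        = (t : ℝ)⁻¹ * ((if ε i then (a * t : ℤ) - z i else z i : ℤ) : ℝ) := by
      intro i
      split_ifs
      · push_cast
        field_simp
      · rfl
    simp only [this]
    rw [← Finset.mul_sum, le_inv_mul_iff₀ ht', mul_comm]
    exact_mod_cast Iff.rfl

lemma latticePointCount_chiseledCube {n a b t : ℕ} (hb : 0 < b) (hab : 2 * b ≤ a) (ht : 0 < t) :
    latticePointCount (chiseledCube n a b) t + 2 ^ n * (n + (b * t - 1)).choose n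
      = (a * t + 1) ^ n := by
  classical
  have hbt : 0 < b * t := Nat.mul_pos hb ht
  have habt : 2 * (b * t) ≤ a * t := by nlinarith
  set box : Finset (Fin n → ℤ) := Fintype.piFinset fun _ => Finset.Icc 0 (a * t : ℤ)
  set bad := (Finset.univ : Finset (Fin n → Bool)).biUnion (cornerPoints n (a * t) (b * t))
  have hset : {z : Fin n → ℤ | intVec z ∈ (t : ℝ) • chiseledCube n a b}
      = ((box \ bad : Finset (Fin n → ℤ)) : Set (Fin n → ℤ)) := by
    ext z
    simp only [Set.mem_ofPred_eq, intVec_mem_smul_chiseledCube ht, Finset.coe_sdiff, Set.mem_sdiff,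
      Finset.mem_coe, box, bad, Fintype.mem_piFinset, Finset.mem_Icc, Finset.mem_biUnion,
      Finset.mem_univ, true_and, mem_cornerPoints, not_exists, not_and, not_lt]
    exact and_congr_right fun h => ⟨fun H ε _ => H ε, fun H ε => H ε h⟩
  have hsub : bad ⊆ box := Finset.biUnion_subset.2 fun ε _ => Finset.filter_subset _ _
  have hbad : bad.card = 2 ^ n * (n + (b * t - 1)).choose n := by
    rw [Finset.card_biUnion (pairwiseDisjoint_cornerPoints n _ _ (by exact_mod_cast habt) _)]
    have hm : (b * t : ℤ) = ((b * t - 1 : ℕ) : ℤ) + 1 := by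
      have : b * t = (b * t - 1) + 1 := by omega
      exact_mod_cast this
    have hA : ((b * t - 1 : ℕ) : ℤ) ≤ a * t := by
      have : b * t - 1 ≤ a * t := by omega
      exact_mod_cast this
    rw [hm]
    simp [card_cornerPoints n _ _ hA]
  have hbox : box.card = (a * t + 1) ^ n := by
    simp only [box, Fintype.card_piFinset_const, Int.card_Icc]
    congr 1
  rw [latticePointCount, hset, Set.ncard_coe_finset, ← hbad, ← hbox]
  exact Finset.card_sdiff_add_card_eq_card hsub

lemma coeff_one_ascPochhammer_succ (n : ℕ) :
    (ascPochhammer ℚ (n + 1)).coeff 1 = n.factorial := by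
  rw [ascPochhammer_succ_left, coeff_X_mul, coeff_zero_eq_eval_zero, eval_comp]
  simp

/-- The Ehrhart polynomial of `chiseledCube n a b`. -/
noncomputable def chiseledCubeEhrhart (n a b : ℕ) : ℚ[X] :=
  ((X + 1) ^ n).comp (C (a : ℚ) * X) -
    C (2 ^ n / n.factorial : ℚ) * (ascPochhammer ℚ n).comp (C (b : ℚ) * X)

lemma eval_chiseledCubeEhrhart {n a b t : ℕ} (hn : 0 < n) (hb : 0 < b) (hab : 2 * b ≤ a)
    (ht : 0 < t) :
    (chiseledCubeEhrhart n a b).eval (t : ℚ) = latticePointCount (chiseledCube n a b) t := by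
  have h := latticePointCount_chiseledCube (n := n) hb hab ht
  have hbt : 0 < b * t := Nat.mul_pos hb ht
  have hc := Nat.cast_choose_eq_ascPochhammer_div ℚ (n + (b * t - 1)) n
  rw [show n + (b * t - 1) - (n - 1) = b * t by omega] at hc
  have h' : (latticePointCount (chiseledCube n a b) t : ℚ)
      + 2 ^ n * ((n + (b * t - 1)).choose n : ℚ) = (a * t + 1) ^ n := by
    exact_mod_cast h
  rw [hc, Nat.cast_mul] at h'
  simp only [chiseledCubeEhrhart, eval_sub, eval_mul, eval_comp, eval_pow, eval_add, eval_X,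
    eval_one, eval_C]
  rw [← h']
  ring

lemma coeff_one_chiseledCubeEhrhart {n : ℕ} (a b : ℕ) (hn : 0 < n) :
    (chiseledCubeEhrhart n a b).coeff 1 = a * (n : ℚ) - 2 ^ n * b / n := by
  obtain ⟨k, rfl⟩ := Nat.exists_eq_succ_of_ne_zero hn.ne'
  have hk : (k.factorial : ℚ) ≠ 0 := by exact_mod_cast k.factorial_ne_zero
  have hk' : ((k + 1 : ℕ) : ℚ) ≠ 0 := by exact_mod_cast k.succ_ne_zero
  rw [chiseledCubeEhrhart, coeff_sub, coeff_C_mul, comp_C_mul_X_coeff, comp_C_mul_X_coeff,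
    Nat.succ_eq_add_one, coeff_one_ascPochhammer_succ, coeff_X_add_one_pow, Nat.choose_one_right,
    Nat.factorial_succ, Nat.cast_mul]
  field_simp

lemma five_mul_sq_lt_two_pow {n : ℕ} (hn : 7 ≤ n) : 5 * n ^ 2 < 2 ^ (n + 1) := by
  induction n, hn using Nat.le_induction with
  | base => norm_num
  | succ n hn ih =>
    rw [pow_succ 2 (n + 1)]
    nlinarith

/-- For `n ≥ 7`, the Ehrhart polynomial of `Q_n(5,2)` has linear coefficient
`5n − 2^(n+1)/n`, which is strictly negative. -/
theorem chiseledCube_negative_linear_coeff (n : ℕ) (hn : 7 ≤ n) :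
    ∃ p : Polynomial ℚ,
      (∀ t : ℕ, 0 < t → p.eval (t : ℚ) = latticePointCount (chiseledCube n 5 2) t) ∧
      p.coeff 1 = 5 * (n : ℚ) - 2 ^ (n + 1) / n ∧ p.coeff 1 < 0 := by
  have hn0 : 0 < n := by omega
  have hcoeff : (chiseledCubeEhrhart n 5 2).coeff 1 = 5 * (n : ℚ) - 2 ^ (n + 1) / n := by
    rw [coeff_one_chiseledCubeEhrhart 5 2 hn0, pow_succ]
    norm_num
  refine ⟨chiseledCubeEhrhart n 5 2,
    fun t ht => eval_chiseledCubeEhrhart hn0 two_pos (by norm_num) ht, hcoeff, ?_⟩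
  have hn' : (0 : ℚ) < n := by exact_mod_cast hn0
  have hpow : (5 * n ^ 2 : ℚ) < 2 ^ (n + 1) := by exact_mod_cast five_mul_sq_lt_two_pow hn
  rw [hcoeff, sub_neg, lt_div_iff₀ hn']
  linarith
end

section
/- Let n ≥ 1 and let a_1, …, a_n, b be positive integers with b < a_i for every i. Let P = {x ∈ ℝ^n : 0 ≤ x_i ≤ a_i for all i, and Σ_{i=1}^n x_i ≥ b}. Then there exists a polynomial p ∈ ℚ[t] such that p(t) = |tP ∩ ℤ^n| for every positive integer t, and every coefficient of p is strictly positive. -/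
open Pointwise Polynomial

/-- The box `∏_i [0, a_i]` with the corner at the origin chiseled off at distance `b`. -/
def chiseledBox (n : ℕ) (a : Fin n → ℕ) (b : ℕ) : Set (Fin n → ℝ) :=
  {x | (∀ i, 0 ≤ x i ∧ x i ≤ (a i : ℝ)) ∧ (b : ℝ) ≤ ∑ i, x i}

theorem card_piAntidiag_univ_nat (n k : ℕ) :
    (Finset.piAntidiag (Finset.univ : Finset (Fin n)) k).card = n.multichoose k := by
  have h := Finset.card_finsuppAntidiag_nat_eq_multichoose (s := (Finset.univ : Finset (Fin n))) k
  rw [Finset.card_univ, Fintype.card_fin] at h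
  rw [← h, Finset.finsuppAntidiag, Finset.card_map, Finset.card_attach]

theorem sum_multichoose_range_succ (n m : ℕ) :
    ∑ k ∈ Finset.range (m + 1), n.multichoose k = (n + 1).multichoose m := by
  induction m with
  | zero => simp
  | succ m ih => rw [Finset.sum_range_succ, ih, Nat.multichoose_succ_succ, add_comm]

/-- If the box `[0, c]` contains all natural vectors with sum at most `m`, then the number of
these is `(n + 1).multichoose m`. -/
theorem card_filter_Icc_sum_le {n m : ℕ} {c : Fin n → ℕ} (hc : ∀ i, m ≤ c i) :
    ((Finset.Icc 0 c).filter fun f => ∑ i, f i ≤ m).card = (n + 1).multichoose m := by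
  classical
  have h : ((Finset.Icc 0 c).filter fun f => ∑ i, f i ≤ m) =
      (Finset.range (m + 1)).biUnion fun k => Finset.piAntidiag Finset.univ k := by
    ext f
    simp only [Finset.mem_filter, Finset.mem_Icc, zero_le, true_and, Finset.mem_biUnion,
      Finset.mem_range, Finset.mem_piAntidiag, Finset.mem_univ, implies_true, and_true,
      exists_eq_right', Order.lt_add_one_iff, and_iff_right_iff_imp]
    exact fun hf i =>
      ((Finset.single_le_sum (fun j _ => Nat.zero_le (f j)) (Finset.mem_univ i)).trans hf).trans
        (hc i)
  rw [h, Finset.card_biUnion, ← sum_multichoose_range_succ]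
  · exact Finset.sum_congr rfl fun k _ => card_piAntidiag_univ_nat n k
  · intro k _ l _ hkl
    refine Finset.disjoint_left.2 fun f hf hf' => ?_
    rw [Finset.mem_piAntidiag] at hf hf'
    exact hkl (hf.1.symm.trans hf'.1)

theorem mem_smul_chiseledBox {n : ℕ} {a : Fin n → ℕ} {b t : ℕ} (ht : 0 < t) (x : Fin n → ℝ) :
    x ∈ (t : ℝ) • chiseledBox n a b ↔
      (∀ i, 0 ≤ x i ∧ x i ≤ (t * a i : ℝ)) ∧ (t * b : ℝ) ≤ ∑ i, x i := by
  have ht' : (0 : ℝ) < t := by exact_mod_cast ht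
  rw [Set.mem_smul_set_iff_inv_smul_mem₀ ht'.ne']
  simp only [chiseledBox, Set.mem_ofPred_eq, Pi.smul_apply, smul_eq_mul, ← Finset.mul_sum,
    inv_mul_le_iff₀ ht', le_inv_mul_iff₀ ht', mul_zero]

theorem latticePointCount_chiseledBox {n : ℕ} {a : Fin n → ℕ} {b t : ℕ} (ht : 0 < t) :
    latticePointCount (chiseledBox n a b) t =
      ((Finset.Icc 0 (fun i => t * a i)).filter fun f => t * b ≤ ∑ i, f i).card := by
  have hinj : Function.Injective fun (f : Fin n → ℕ) i => (f i : ℤ) := fun f g h =>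
    funext fun i => Int.ofNat_injective (congrFun h i)
  rw [latticePointCount, ← Set.ncard_coe_finset, ← Set.ncard_image_of_injective _ hinj]
  congr 1
  ext z
  simp only [Set.mem_ofPred_eq, mem_smul_chiseledBox ht, intVec, Set.mem_image, Finset.mem_coe,
    Finset.mem_filter, Finset.mem_Icc, zero_le, true_and, Pi.le_def]
  constructor
  · rintro ⟨h₁, h₂⟩
    have hz : ∀ i, 0 ≤ z i := fun i => by exact_mod_cast (h₁ i).1
    lift z to Fin n → ℕ using hz
    exact ⟨z, ⟨fun i => by
      have h := (h₁ i).2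
      beta_reduce at h
      exact_mod_cast h, by exact_mod_cast h₂⟩, rfl⟩
  · rintro ⟨f, ⟨h₁, h₂⟩, rfl⟩
    exact ⟨fun i => ⟨by positivity, by
      have h := h₁ i
      beta_reduce
      exact_mod_cast h⟩, by exact_mod_cast h₂⟩

theorem latticePointCount_chiseledBox_add {n : ℕ} {a : Fin n → ℕ} {b t : ℕ} (ht : 0 < t)
    (hb : 0 < b) (hba : ∀ i, b < a i) :
    latticePointCount (chiseledBox n a b) t + (t * b + n - 1).choose n =
      ∏ i, (t * a i + 1) := by
  obtain ⟨m, hm⟩ : ∃ m, t * b = m + 1 :=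
    Nat.exists_eq_succ_of_ne_zero (Nat.mul_pos ht hb).ne'
  have hcard := Finset.card_filter_add_card_filter_not
    (s := Finset.Icc 0 (fun i => t * a i)) (fun f : Fin n → ℕ => t * b ≤ ∑ i, f i)
  have hc : ∀ i, m ≤ t * a i := fun i => by
    have := Nat.mul_le_mul_left t (hba i).le
    omega
  have hsmall := card_filter_Icc_sum_le hc
  rw [latticePointCount_chiseledBox ht]
  simp only [hm, not_le, Order.lt_add_one_iff] at hcard ⊢
  rw [hsmall, Nat.multichoose_eq, Pi.card_Icc] at hcard
  have hch : (m + 1 + n - 1).choose n = (n + 1 + m - 1).choose m := by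
    rw [show m + 1 + n - 1 = m + n by omega, show n + 1 + m - 1 = m + n by omega,
      Nat.choose_symm_add]
  rw [hch, hcard]
  simp

theorem ascPochhammer_coeff_nonneg (n k : ℕ) : 0 ≤ (ascPochhammer ℚ n).coeff k := by
  rw [← ascPochhammer_map (Nat.castRingHom ℚ), coeff_map]
  exact Nat.cast_nonneg _

theorem ascPochhammer_coeff_le_factorial (n k : ℕ) :
    (ascPochhammer ℚ n).coeff k ≤ n.factorial := by
  rw [← ascPochhammer_eval_one, eval_eq_sum_range]
  simp only [one_pow, mul_one]
  rcases le_or_gt k (ascPochhammer ℚ n).natDegree with hk | hk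
  · exact Finset.single_le_sum (fun j _ => ascPochhammer_coeff_nonneg n j)
      (Finset.mem_range_succ_iff.2 hk)
  · rw [coeff_eq_zero_of_natDegree_lt hk]
    exact Finset.sum_nonneg fun j _ => ascPochhammer_coeff_nonneg n j

theorem pow_le_coeff_prod_C_mul_X_add_one {ι : Type*} (s : Finset ι) (a : ι → ℚ) {c : ℚ}
    (hc : 0 ≤ c) (ha : ∀ i ∈ s, c ≤ a i) (k : ℕ) :
    0 ≤ (∏ i ∈ s, (C (a i) * X + 1)).coeff k ∧
      (k ≤ s.card → c ^ k ≤ (∏ i ∈ s, (C (a i) * X + 1)).coeff k) := by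
  classical
  induction s using Finset.induction_on generalizing k with
  | empty =>
    rw [Finset.prod_empty, coeff_one]
    refine ⟨by split_ifs <;> norm_num, fun hk => ?_⟩
    obtain rfl : k = 0 := by simpa using hk
    simp
  | insert i s hi ih =>
    have hs := ih fun j hj => ha j (Finset.mem_insert_of_mem hj)
    have hai := ha i (Finset.mem_insert_self i s)
    rw [Finset.prod_insert hi, Finset.card_insert_of_notMem hi, add_mul, one_mul, mul_assoc,
      coeff_add, coeff_C_mul]
    rcases k with _ | k
    · rw [coeff_X_mul_zero, mul_zero, zero_add]
      exact ⟨(hs 0).1, fun _ => (hs 0).2 (Nat.zero_le _)⟩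
    · rw [coeff_X_mul]
      refine ⟨add_nonneg (mul_nonneg (hc.trans hai) (hs k).1) (hs (k + 1)).1, fun hk => ?_⟩
      have h := mul_le_mul hai ((hs k).2 (by omega)) (pow_nonneg hc k) (hc.trans hai)
      rw [pow_succ']
      linarith [(hs (k + 1)).1]

/-- The Ehrhart polynomial of the chiseled box. -/
noncomputable def chiseledBoxEhrhart (n : ℕ) (a : Fin n → ℕ) (b : ℕ) : ℚ[X] :=
  ∏ i, (C (a i : ℚ) * X + 1) - C ((n.factorial : ℚ)⁻¹) * (ascPochhammer ℚ n).comp (C (b : ℚ) * X)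

theorem eval_chiseledBoxEhrhart (n : ℕ) (a : Fin n → ℕ) (b t : ℕ) :
    (chiseledBoxEhrhart n a b).eval (t : ℚ) =
      ∏ i, ((t : ℚ) * a i + 1) - (t * b + n - 1).choose n := by
  have h : (ascPochhammer ℚ n).eval ((b : ℚ) * t) =
      n.factorial * (t * b + n - 1).choose n := by
    rw [mul_comm, ← Nat.cast_mul, ascPochhammer_nat_eq_natCast_ascFactorial,
      Nat.ascFactorial_eq_factorial_mul_choose', Nat.cast_mul]
  simp only [chiseledBoxEhrhart, eval_sub, eval_prod, eval_add, eval_mul, eval_C, eval_X,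
    eval_one, eval_comp, h]
  rw [inv_mul_cancel_left₀ (Nat.cast_ne_zero.2 n.factorial_ne_zero)]
  simp only [mul_comm]

theorem natDegree_chiseledBoxEhrhart_le (n : ℕ) (a : Fin n → ℕ) (b : ℕ) :
    (chiseledBoxEhrhart n a b).natDegree ≤ n := by
  refine (natDegree_sub_le _ _).trans (max_le ?_ ?_)
  · refine (natDegree_prod_le _ _).trans ?_
    refine (Finset.sum_le_card_nsmul _ _ 1 fun i _ => ?_).trans (by simp)
    exact natDegree_linear_le
  · refine (natDegree_C_mul_le _ _).trans (natDegree_comp_le.trans ?_)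
    rw [ascPochhammer_natDegree]
    exact (Nat.mul_le_mul_left n ((natDegree_C_mul_le _ _).trans natDegree_X_le)).trans_eq (mul_one n)

theorem coeff_chiseledBoxEhrhart_pos {n : ℕ} (hn : 1 ≤ n) {a : Fin n → ℕ} {b : ℕ}
    (hba : ∀ i, b < a i) {k : ℕ} (hk : k ≤ n) :
    0 < (chiseledBoxEhrhart n a b).coeff k := by
  have hprod := (pow_le_coeff_prod_C_mul_X_add_one Finset.univ (fun i => (a i : ℚ))
    (c := b + 1) (by positivity) (fun i _ => by exact_mod_cast hba i) k).2 (by simpa using hk)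
  have hfac : (0 : ℚ) < n.factorial := by exact_mod_cast n.factorial_pos
  rw [chiseledBoxEhrhart, coeff_sub, coeff_C_mul, comp_C_mul_X_coeff, sub_pos]
  refine lt_of_lt_of_le ?_ hprod
  rcases Nat.eq_zero_or_pos k with rfl | hk0
  · rw [coeff_zero_eq_eval_zero, ascPochhammer_ne_zero_eval_zero ℚ (by omega)]
    simp
  · calc (n.factorial : ℚ)⁻¹ * ((ascPochhammer ℚ n).coeff k * (b : ℚ) ^ k)
        ≤ (n.factorial : ℚ)⁻¹ * (n.factorial * (b : ℚ) ^ k) := by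
          gcongr
          exact ascPochhammer_coeff_le_factorial n k
      _ = (b : ℚ) ^ k := inv_mul_cancel_left₀ hfac.ne' _
      _ < ((b : ℚ) + 1) ^ k := pow_lt_pow_left₀ (lt_add_one _) (Nat.cast_nonneg b) hk0.ne'

/-- For `n ≥ 1` and positive integers `a_1, …, a_n, b` with `b < a_i` for all `i`,
the Ehrhart polynomial of the chiseled box has only strictly positive coefficients. -/
theorem chiseledBox_ehrhart_positive (n : ℕ) (hn : 1 ≤ n) (a : Fin n → ℕ) (b : ℕ)
    (ha : ∀ i, 0 < a i) (hb : 0 < b) (hba : ∀ i, b < a i) :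
    ∃ p : Polynomial ℚ,
      (∀ t : ℕ, 0 < t → p.eval (t : ℚ) = latticePointCount (chiseledBox n a b) t) ∧
      ∀ j ≤ p.natDegree, 0 < p.coeff j := by
  refine ⟨chiseledBoxEhrhart n a b, fun t ht => ?_, fun j hj =>
    coeff_chiseledBoxEhrhart_pos hn hba (hj.trans (natDegree_chiseledBoxEhrhart_le n a b))⟩
  rw [eval_chiseledBoxEhrhart, sub_eq_iff_eq_add]
  exact_mod_cast (latticePointCount_chiseledBox_add ht hb hba).symm
end

section
/- Let n ≥ 1 and let a_1, …, a_n, b be positive integers with b < a_i for every i. Then every coefficient of the polynomial ∏_{i=1}^n (a_i X + 1) − (1/n!)·∏_{j=0}^{n−1}(b X + j) ∈ ℚ[X] is strictly positive (its constant coefficient equals 1). -/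
open Polynomial

theorem Polynomial.coeff_prod_nonneg_and_le {R ι : Type*} [CommRing R] [PartialOrder R]
    [IsOrderedRing R] (s : Finset ι) (p q : ι → R[X])
    (hp : ∀ i k, 0 ≤ (p i).coeff k) (hpq : ∀ i k, (p i).coeff k ≤ (q i).coeff k) (k : ℕ) :
    0 ≤ (∏ i ∈ s, p i).coeff k ∧ (∏ i ∈ s, p i).coeff k ≤ (∏ i ∈ s, q i).coeff k := by
  classical
  induction s using Finset.induction_on generalizing k with
  | empty =>
    simp only [Finset.prod_empty, le_refl, and_true, coeff_one]
    split_ifs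
    exacts [zero_le_one, le_rfl]
  | insert i s hi ih =>
    rw [Finset.prod_insert hi, Finset.prod_insert hi, coeff_mul, coeff_mul]
    exact ⟨Finset.sum_nonneg fun x _ => mul_nonneg (hp i x.1) (ih x.2).1,
      Finset.sum_le_sum fun x _ => mul_le_mul (hpq i x.1) (ih x.2).2 (ih x.2).1
        ((hp i x.1).trans (hpq i x.1))⟩

theorem Polynomial.coeff_C_mul_X_add_one_pow {R : Type*} [CommSemiring R] (c : R) (n k : ℕ) :
    ((C c * X + 1) ^ n).coeff k = n.choose k * c ^ k := by
  have h : (C c * X + 1) ^ n = ((X + 1) ^ n).comp (C c * X) := by simp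
  rw [h, comp_C_mul_X_coeff, coeff_X_add_one_pow]

theorem Polynomial.coeff_C_mul_X_add_C {R : Type*} [Semiring R] (c d : R) (k : ℕ) :
    (C c * X + C d).coeff k = if k = 0 then d else if k = 1 then c else 0 := by
  rcases k with _ | _ | k <;> simp [coeff_X, coeff_C]

theorem Polynomial.C_inv_factorial_mul_prod (n : ℕ) (b : ℚ) :
    C ((n.factorial : ℚ))⁻¹ * ∏ j ∈ Finset.range n, (C b * X + C (j : ℚ)) =
      ∏ j ∈ Finset.range n, (C (b / (j + 1)) * X + C ((j : ℚ) / (j + 1))) := by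
  have h : ∀ j : ℕ, C (b / (j + 1)) * X + C ((j : ℚ) / (j + 1)) =
      C ((j : ℚ) + 1)⁻¹ * (C b * X + C (j : ℚ)) := fun j => by
    simp only [div_eq_mul_inv, C_mul]
    ring
  simp_rw [h]
  rw [Finset.prod_mul_distrib, ← map_prod, Finset.prod_inv_distrib,
    ← Finset.prod_range_add_one_eq_factorial]
  push_cast
  rfl

/-- For `n ≥ 1` and positive integers `a_1, …, a_n, b` with `b < a_i` for all `i`,
every coefficient of the polynomial
`∏_i (a_i X + 1) − (1/n!) · ∏_{j=0}^{n−1} (bX + j)` is strictly positive,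
and its constant coefficient equals `1`. -/
theorem chiseledBox_polynomial_positive (n : ℕ) (hn : 1 ≤ n) (a : Fin n → ℕ) (b : ℕ)
    (ha : ∀ i, 0 < a i) (hb : 0 < b) (hba : ∀ i, b < a i) :
    (∀ k ≤ n, 0 <
        ((∏ i, (C (a i : ℚ) * X + 1)) -
          C ((n.factorial : ℚ))⁻¹ * ∏ j ∈ Finset.range n, (C (b : ℚ) * X + C (j : ℚ))).coeff k) ∧
      ((∏ i, (C (a i : ℚ) * X + 1)) -
          C ((n.factorial : ℚ))⁻¹ * ∏ j ∈ Finset.range n, (C (b : ℚ) * X + C (j : ℚ))).coeff 0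
        = 1 := by
  have h_zero : ((∏ i, (C (a i : ℚ) * X + 1)) - C ((n.factorial : ℚ))⁻¹ *
      ∏ j ∈ Finset.range n, (C (b : ℚ) * X + C (j : ℚ))).coeff 0 = 1 := by
    have h : ∏ j ∈ Finset.range n, (j : ℚ) = 0 :=
      Finset.prod_eq_zero (Finset.mem_range.2 hn) Nat.cast_zero
    simp [coeff_zero_eq_eval_zero, eval_prod, h]
  refine ⟨fun k hk => ?_, h_zero⟩
  rcases Nat.eq_zero_or_pos k with rfl | hk0
  · rw [h_zero]
    exact one_pos
  have h_upper : (C ((n.factorial : ℚ))⁻¹ *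
      ∏ j ∈ Finset.range n, (C (b : ℚ) * X + C (j : ℚ))).coeff k ≤ n.choose k * (b : ℚ) ^ k := by
    rw [C_inv_factorial_mul_prod, ← coeff_C_mul_X_add_one_pow]
    have h := (coeff_prod_nonneg_and_le (Finset.range n)
      (fun j : ℕ => C ((b : ℚ) / (j + 1)) * X + C ((j : ℚ) / (j + 1)))
      (fun _ => C (b : ℚ) * X + C 1) (fun j k => ?_) (fun j k => ?_) k).2
    · simpa using h
    · rw [coeff_C_mul_X_add_C]
      split_ifs <;> positivity
    · rw [coeff_C_mul_X_add_C, coeff_C_mul_X_add_C]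
      split_ifs
      · exact div_le_one_of_le₀ (by linarith) (by positivity)
      · exact div_le_self (by positivity) (by simp)
      · exact le_rfl
  have h_lower : n.choose k * ((b : ℚ) + 1) ^ k ≤ (∏ i, (C (a i : ℚ) * X + 1)).coeff k := by
    rw [← coeff_C_mul_X_add_one_pow]
    have h := (coeff_prod_nonneg_and_le (Finset.univ : Finset (Fin n))
      (fun _ => C ((b : ℚ) + 1) * X + C 1) (fun i => C (a i : ℚ) * X + C 1)
      (fun i k => ?_) (fun i k => ?_) k).2
    · simpa using h
    · rw [coeff_C_mul_X_add_C]
      split_ifs <;> positivity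
    · rw [coeff_C_mul_X_add_C, coeff_C_mul_X_add_C]
      split_ifs
      · exact le_rfl
      · exact_mod_cast hba i
      · exact le_rfl
  have h_strict : n.choose k * (b : ℚ) ^ k < n.choose k * ((b : ℚ) + 1) ^ k :=
    mul_lt_mul_of_pos_left (pow_lt_pow_left₀ (lt_add_one _) (Nat.cast_nonneg b) hk0.ne')
      (Nat.cast_pos.2 (Nat.choose_pos hk))
  rw [coeff_sub]
  linarith
end
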